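/- Let f = (f_1,…,f_n) be polynomials in R[x] with each deg f_i ≥ 1, δ_f = Σ_{i=1}^n (deg f_i − 1), and let δ_1, δ_2 ≥ 0 be integers. For i = 1,2 let L_i be an R-linear functional on R[x] that annuls (f)^{≤δ_f+δ_i}_x. Fix monotonous difference derivatives ∇f_i of the f_i and, for each F ∈ R[x], a monotonous difference derivative ∇F. Then for every F ∈ R[x] of total degree ≤ δ_f + δ_1 + δ_2 + 1: L_1(x_*).( L_2(y_*).det‖∇f(x,y) ∇F(x,y); f(x) F(x)‖ ) = L_2(x_*).( L_1(y_*).det‖∇f(x,y) ∇F(x,y); f(x) F(x)‖ ); that is, the extension operation is symmetric in the two bounded root functionals L_1 and L_2 on polynomials of degree ≤ δ_f + δ_1 + δ_2 + 1. -/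

import Mathlib

open MvPolynomial Finset

noncomputable section

variable {R : Type*} [CommRing R] {n : ℕ}

/-- Total degree of a multivariate polynomial, valued in `WithBot ℤ`,
with the convention `deg 0 = ⊥` (i.e. `-∞`). -/
def mdeg {σ S : Type*} [CommSemiring S] (F : MvPolynomial σ S) : WithBot ℤ :=
  F.support.sup fun m => ((m.sum fun _ e => e : ℕ) : ℤ)

/-- The embedding `R[x] → R[x,y]`, `x_i ↦ x_i` (the x-variables are `Sum.inl`,
the y-variables are `Sum.inr`). -/
def toX : MvPolynomial (Fin n) R →ₐ[R] MvPolynomial (Fin n ⊕ Fin n) R :=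
  rename Sum.inl

/-- The embedding `R[x] → R[x,y]`, `x_i ↦ y_i`. -/
def toY : MvPolynomial (Fin n) R →ₐ[R] MvPolynomial (Fin n ⊕ Fin n) R :=
  rename Sum.inr

/-- `D = (∇¹F, …, ∇ⁿF)` is a difference derivative of `F`:
`∑ k, (x_k - y_k) * ∇ᵏF(x,y) = F(x) - F(y)`. -/
def IsDiffDeriv (F : MvPolynomial (Fin n) R)
    (D : Fin n → MvPolynomial (Fin n ⊕ Fin n) R) : Prop :=
  ∑ k : Fin n, (X (Sum.inl k) - X (Sum.inr k)) * D k = toX F - toY F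

/-- A difference derivative of `F` is monotonous if each component has total degree
`≤ deg F - 1` (equivalently `deg (∇ᵏF) + 1 ≤ deg F` in `WithBot ℤ`). -/
def IsMonotonous (F : MvPolynomial (Fin n) R)
    (D : Fin n → MvPolynomial (Fin n ⊕ Fin n) R) : Prop :=
  ∀ k, mdeg (D k) + 1 ≤ mdeg F

/-- `δ_f = ∑ᵢ (deg fᵢ - 1)`. -/
def deltaF (f : Fin n → MvPolynomial (Fin n) R) : ℤ :=
  ∑ i, (((f i).totalDegree : ℤ) - 1)

/-- `(f)^{≤ d}_x`: sums `∑ fᵢ gᵢ` with `deg fᵢ + deg gᵢ ≤ d` for every `i`. -/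
def boundedSpan (f : Fin n → MvPolynomial (Fin n) R) (d : WithBot ℤ) :
    Set (MvPolynomial (Fin n) R) :=
  {F | ∃ g : Fin n → MvPolynomial (Fin n) R,
    F = ∑ i, f i * g i ∧ ∀ i, mdeg (f i) + mdeg (g i) ≤ d}

/-- A linear functional `L` annuls a set `S` if it vanishes on it. -/
def Annuls (L : MvPolynomial (Fin n) R →ₗ[R] R) (S : Set (MvPolynomial (Fin n) R)) : Prop :=
  ∀ F ∈ S, L F = 0

/-- `L(y_*).P` : apply the functional `L` to the `y`-part of `P ∈ R[x,y]`,
i.e. if `P = ∑_α A_α(x) y^α` then `L(y_*).P = ∑_α L(y^α) • A_α(x)`. -/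
def applyY (L : MvPolynomial (Fin n) R →ₗ[R] R) (P : MvPolynomial (Fin n ⊕ Fin n) R) :
    MvPolynomial (Fin n) R :=
  ∑ m ∈ P.support,
    C (L (monomial (Finsupp.sumFinsuppAddEquivProdFinsupp m).2 (1 : R)) * P.coeff m) *
      monomial (Finsupp.sumFinsuppAddEquivProdFinsupp m).1 (1 : R)

/-- `det‖∇f(x,y) ∇F(x,y); f(x) F(x)‖` : the `(n+1) × (n+1)` determinant whose entry `(k,i)`
is `∇ᵏfᵢ(x,y)` for `k, i ≤ n`, entry `(k, n+1)` is `∇ᵏF(x,y)`, entry `(n+1, i)` is `fᵢ(x)`,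
and entry `(n+1, n+1)` is `F(x)`.  Here `Df i` is the tuple `(∇¹fᵢ, …, ∇ⁿfᵢ)`. -/
def ddetX (f : Fin n → MvPolynomial (Fin n) R)
    (Df : Fin n → Fin n → MvPolynomial (Fin n ⊕ Fin n) R)
    (F : MvPolynomial (Fin n) R) (DF : Fin n → MvPolynomial (Fin n ⊕ Fin n) R) :
    MvPolynomial (Fin n ⊕ Fin n) R :=
  Matrix.det (Matrix.of fun k i : Fin (n + 1) =>
    if hk : (k : ℕ) < n then
      if hi : (i : ℕ) < n then Df ⟨i, hi⟩ ⟨k, hk⟩ else DF ⟨k, hk⟩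
    else
      if hi : (i : ℕ) < n then toX (f ⟨i, hi⟩) else toX F)

/-- `det‖∇f(x,y) ∇F(x,y); f(y) F(y)‖` : as `ddetX` but with last row `(f₁(y),…,fₙ(y),F(y))`. -/
def ddetY (f : Fin n → MvPolynomial (Fin n) R)
    (Df : Fin n → Fin n → MvPolynomial (Fin n ⊕ Fin n) R)
    (F : MvPolynomial (Fin n) R) (DF : Fin n → MvPolynomial (Fin n ⊕ Fin n) R) :
    MvPolynomial (Fin n ⊕ Fin n) R :=
  Matrix.det (Matrix.of fun k i : Fin (n + 1) =>
    if hk : (k : ℕ) < n then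
      if hi : (i : ℕ) < n then Df ⟨i, hi⟩ ⟨k, hk⟩ else DF ⟨k, hk⟩
    else
      if hi : (i : ℕ) < n then toY (f ⟨i, hi⟩) else toY F)


/-- `P` has total degree at most `d`. -/
def WD {σ : Type*} (d : ℤ) (P : MvPolynomial σ R) : Prop :=
  ∀ m, coeff m P ≠ 0 → ((Finsupp.degree m : ℕ) : ℤ) ≤ d

theorem WD.mono {σ : Type*} {d d' : ℤ} {P : MvPolynomial σ R} (h : WD d P) (hd : d ≤ d') :
    WD d' P := fun m hm => (h m hm).trans hd

theorem WD.zero {σ : Type*} (d : ℤ) : WD d (0 : MvPolynomial σ R) := by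
  intro m hm; simp at hm

theorem WD.add {σ : Type*} {d : ℤ} {P Q : MvPolynomial σ R} (h : WD d P) (h' : WD d Q) :
    WD d (P + Q) := by
  intro m hm
  by_cases h1 : coeff m P = 0
  · by_cases h2 : coeff m Q = 0
    · simp [h1, h2] at hm
    · exact h' m h2
  · exact h m h1

theorem WD.neg {σ : Type*} {d : ℤ} {P : MvPolynomial σ R} (h : WD d P) : WD d (-P) := by
  intro m hm
  apply h m
  simpa using hm

theorem WD.sub {σ : Type*} {d : ℤ} {P Q : MvPolynomial σ R} (h : WD d P) (h' : WD d Q) :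
    WD d (P - Q) := by
  rw [sub_eq_add_neg]; exact h.add h'.neg

theorem WD.sum {σ ι : Type*} {d : ℤ} (s : Finset ι) (P : ι → MvPolynomial σ R)
    (h : ∀ i ∈ s, WD d (P i)) : WD d (∑ i ∈ s, P i) := by
  classical
  induction s using Finset.induction_on with
  | empty => simpa using WD.zero d
  | insert a s ha ih =>
    rw [Finset.sum_insert ha]
    exact (h a (by simp)).add (ih fun i hi => h i (by simp [hi]))

theorem WD.mul {σ : Type*} {d d' : ℤ} {P Q : MvPolynomial σ R} (h : WD d P) (h' : WD d' Q) :
    WD (d + d') (P * Q) := by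
  classical
  intro m hm
  rw [coeff_mul] at hm
  obtain ⟨p, hp, hne⟩ := Finset.exists_ne_zero_of_sum_ne_zero hm
  rw [Finset.HasAntidiagonal.mem_antidiagonal] at hp
  have h1 := h p.1 (left_ne_zero_of_mul hne)
  have h2 := h' p.2 (right_ne_zero_of_mul hne)
  rw [← hp, map_add]
  push_cast
  linarith

theorem WD.prod {σ ι : Type*} (s : Finset ι) (P : ι → MvPolynomial σ R) (d : ι → ℤ)
    (h : ∀ i ∈ s, WD (d i) (P i)) : WD (∑ i ∈ s, d i) (∏ i ∈ s, P i) := by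
  classical
  induction s using Finset.induction_on with
  | empty =>
    intro m hm
    simp only [Finset.prod_empty, coeff_one, ne_eq, ite_eq_right_iff, Classical.not_imp] at hm
    simp [← hm.1]
  | insert a s ha ih =>
    rw [Finset.sum_insert ha, Finset.prod_insert ha]
    exact (h a (by simp)).mul (ih fun i hi => h i (by simp [hi]))

theorem WD.monomial {σ : Type*} (m : σ →₀ ℕ) (c : R) :
    WD ((Finsupp.degree m : ℕ) : ℤ) (MvPolynomial.monomial m c) := by
  classical
  intro k hk
  rw [coeff_monomial] at hk
  split_ifs at hk with h
  · rw [h]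
  · simp at hk

theorem WD.X {σ : Type*} (i : σ) : WD 1 (X i : MvPolynomial σ R) := by
  have := WD.monomial (R := R) (Finsupp.single i 1) 1
  rw [Finsupp.degree_single] at this
  exact_mod_cast this

theorem WD.rename {σ τ : Type*} (e : σ → τ) {d : ℤ} {P : MvPolynomial σ R} (h : WD d P) :
    WD d (MvPolynomial.rename e P) := by
  rw [P.as_sum, map_sum]
  apply WD.sum
  intro m hm
  rw [rename_monomial]
  refine (WD.monomial _ _).mono ?_
  rw [Finsupp.degree_mapDomain]
  exact h m (by simpa using hm)

theorem mdeg_le_iff {σ : Type*} (P : MvPolynomial σ R) (d : ℤ) :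
    mdeg P ≤ (d : WithBot ℤ) ↔ WD d P := by
  unfold mdeg WD
  rw [Finset.sup_le_iff]
  simp only [mem_support_iff, WithBot.coe_le_coe]
  rfl

theorem wd_totalDegree {σ : Type*} (P : MvPolynomial σ R) : WD (P.totalDegree : ℤ) P := by
  intro m hm
  have := le_totalDegree (p := P) (s := m) (by simpa using hm)
  exact_mod_cast this

theorem WD.of_mono {F : MvPolynomial (Fin n) R} {D : Fin n → MvPolynomial (Fin n ⊕ Fin n) R}
    (h : IsMonotonous F D) {d : ℤ} (hF : WD d F) (k : Fin n) : WD (d - 1) (D k) := by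
  have h1 := (h k).trans ((mdeg_le_iff F d).2 hF)
  rw [← mdeg_le_iff]
  generalize mdeg (D k) = z at h1
  cases z with
  | bot => exact bot_le
  | coe z =>
    have : ((z + 1 : ℤ) : WithBot ℤ) ≤ d := by simpa using h1
    rw [WithBot.coe_le_coe] at this ⊢
    linarith

/-- `x_k - y_k`. -/
def uu (k : Fin n) : MvPolynomial (Fin n ⊕ Fin n) R := X (Sum.inl k) - X (Sum.inr k)

theorem wd_uu (k : Fin n) : WD 1 (uu k : MvPolynomial (Fin n ⊕ Fin n) R) :=
  (WD.X _).sub (WD.X _)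

theorem uu_cancel (a : Fin n) (P : MvPolynomial (Fin n ⊕ Fin n) R) (h : uu a * P = 0) :
    P = 0 := by
  classical
  let t : MvPolynomial (Fin n ⊕ Fin n) R →ₐ[R] MvPolynomial (Fin n ⊕ Fin n) R :=
    aeval fun i => if i = Sum.inl a then X (Sum.inl a) + X (Sum.inr a) else X i
  let t' : MvPolynomial (Fin n ⊕ Fin n) R →ₐ[R] MvPolynomial (Fin n ⊕ Fin n) R :=
    aeval fun i => if i = Sum.inl a then X (Sum.inl a) - X (Sum.inr a) else X i
  have htt : t'.comp t = AlgHom.id R _ := by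
    ext1 i
    by_cases hi : i = Sum.inl a
    · simp [t, t', hi]
    · simp [t, t', hi]
  have h1 : t (uu a) = X (Sum.inl a) := by simp [t, uu]
  have h2 : X (Sum.inl a) * t P = 0 := by rw [← h1, ← map_mul, h, map_zero]
  have h3 : t P = 0 := by
    rw [← X_mul_cancel_left_iff (i := Sum.inl a), h2, mul_zero]
  have h4 := DFunLike.congr_fun htt P
  simpa [h3] using h4.symm

/-- substitution `x_a := y_a` -/
def sg (a : Fin n) : MvPolynomial (Fin n ⊕ Fin n) R →ₐ[R] MvPolynomial (Fin n ⊕ Fin n) R :=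
  aeval fun i => if i = Sum.inl a then X (Sum.inr a) else X i

theorem sg_uu_self (a : Fin n) : sg a (uu a : MvPolynomial (Fin n ⊕ Fin n) R) = 0 := by
  simp [sg, uu]

theorem sg_uu_ne (a k : Fin n) (h : k ≠ a) :
    sg a (uu k : MvPolynomial (Fin n ⊕ Fin n) R) = uu k := by
  simp [sg, uu, h]

theorem quot_monomial (a : Fin n) (N : ℕ) (m : Fin n ⊕ Fin n →₀ ℕ) (hm : Finsupp.degree m = N)
    (c : R) : ∃ Q : MvPolynomial (Fin n ⊕ Fin n) R, WD ((N : ℤ) - 1) Q ∧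
      monomial m c = sg a (monomial m c) + uu a * Q := by
  classical
  induction N generalizing m with
  | zero =>
    have h0 : m = 0 := (Finsupp.degree_eq_zero_iff m).1 hm
    refine ⟨0, WD.zero _, ?_⟩
    have : (monomial 0 c : MvPolynomial (Fin n ⊕ Fin n) R) = C c := rfl
    rw [h0, this]
    simp [sg]
  | succ N ih =>
    have hm0 : m ≠ 0 := by rintro rfl; simp at hm
    obtain ⟨i, hi⟩ := Finsupp.ne_iff.1 hm0
    have hi' : 1 ≤ m i := Nat.one_le_iff_ne_zero.2 hi
    obtain ⟨m', rfl⟩ : ∃ m', m = m' + Finsupp.single i 1 :=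
      ⟨m - Finsupp.single i 1, (tsub_add_cancel_of_le (by simpa using hi')).symm⟩
    have hm' : Finsupp.degree m' = N := by
      rw [map_add, Finsupp.degree_single] at hm
      omega
    obtain ⟨Q, hQ, hE⟩ := ih m' hm'
    have hmon : (monomial (m' + Finsupp.single i 1) c : MvPolynomial (Fin n ⊕ Fin n) R)
        = monomial m' c * X i := by
      rw [X, monomial_mul, mul_one]
    have hP : WD (N : ℤ) (monomial m' c : MvPolynomial (Fin n ⊕ Fin n) R) := by
      rw [← hm']; exact WD.monomial _ _
    have hS : WD (N : ℤ) (sg a (monomial m' c) : MvPolynomial (Fin n ⊕ Fin n) R) := by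
      have : sg a (monomial m' c) = monomial m' c - uu a * Q := by
        rw [eq_sub_iff_add_eq]; exact hE.symm
      rw [this]
      exact hP.sub (((wd_uu a).mul hQ).mono (by linarith))
    have hQX : WD (N : ℤ) (Q * X i) := (hQ.mul (WD.X i)).mono (by linarith)
    by_cases hia : i = Sum.inl a
    · refine ⟨sg a (monomial m' c) + Q * X i, ?_, ?_⟩
      · push_cast
        exact (hS.add hQX).mono (by linarith)
      · have h1 : sg a (X i : MvPolynomial (Fin n ⊕ Fin n) R) = X (Sum.inr a) := by
          simp [sg, hia]
        rw [hmon, map_mul, h1]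
        generalize sg a (monomial m' c) = S at *
        rw [hE, hia, uu]
        ring
    · refine ⟨Q * X i, ?_, ?_⟩
      · push_cast
        exact hQX.mono (by linarith)
      · have h1 : sg a (X i : MvPolynomial (Fin n ⊕ Fin n) R) = X i := by
          simp [sg, hia]
        rw [hmon, map_mul, h1]
        generalize sg a (monomial m' c) = S at *
        rw [hE]
        ring

theorem quot_exists (a : Fin n) (d : ℤ) (P : MvPolynomial (Fin n ⊕ Fin n) R) (hP : WD d P) :
    ∃ Q : MvPolynomial (Fin n ⊕ Fin n) R, WD (d - 1) Q ∧ P = sg a P + uu a * Q := by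
  choose q hq hq' using fun m : Fin n ⊕ Fin n →₀ ℕ => quot_monomial a _ m rfl (coeff m P)
  refine ⟨∑ m ∈ P.support, q m, ?_, ?_⟩
  · apply WD.sum
    intro m hm
    refine (hq m).mono ?_
    have := hP m (by simpa using hm)
    linarith
  · conv_lhs => rw [P.as_sum]
    conv_rhs => rw [P.as_sum]
    have hs : (∑ v ∈ P.support, monomial v (coeff v P)).support = P.support := by
      rw [← P.as_sum]
    rw [hs, map_sum, Finset.mul_sum, ← Finset.sum_add_distrib]
    apply Finset.sum_congr rfl
    intro m _
    exact (hq' m).trans rfl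

/-- Elementary Koszul relations `A (u_j e_k - u_k e_j)`, with `deg A ≤ d - 1`. -/
def koszulSet (R : Type*) [CommRing R] (n : ℕ) (d : ℤ) :
    Set (Fin n → MvPolynomial (Fin n ⊕ Fin n) R) :=
  {v | ∃ (j k : Fin n) (A : MvPolynomial (Fin n ⊕ Fin n) R), j ≠ k ∧ WD (d - 1) A ∧
    v = Pi.single k (A * uu j) - Pi.single j (A * uu k)}

theorem koszul (d : ℤ) (s : Finset (Fin n)) (D : Fin n → MvPolynomial (Fin n ⊕ Fin n) R)
    (hs : ∀ k, k ∉ s → D k = 0) (hD : ∀ k, WD d (D k)) (h0 : ∑ k, uu k * D k = 0) :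
    D ∈ AddSubmonoid.closure (koszulSet R n d) := by
  classical
  induction s using Finset.induction_on generalizing D with
  | empty =>
    have : D = 0 := funext fun k => hs k (by simp)
    rw [this]; exact zero_mem _
  | insert a s ha ih =>
    choose q hq hq' using fun k => quot_exists a d (D k) (hD k)
    let q0 : Fin n → MvPolynomial (Fin n ⊕ Fin n) R := fun k => if k ∈ s then q k else 0
    let D' : Fin n → MvPolynomial (Fin n ⊕ Fin n) R := fun k => if k = a then 0 else sg a (D k)
    have hD'mem : D' ∈ AddSubmonoid.closure (koszulSet R n d) := by
      apply ih
      · intro k hk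
        by_cases hka : k = a
        · simp [D', hka]
        · simp [D', hka, hs k (by simp [hka, hk])]
      · intro k
        by_cases hka : k = a
        · simpa [D', hka] using WD.zero d
        · have : sg a (D k) = D k - uu a * q k := by
            rw [eq_sub_iff_add_eq]; exact (hq' k).symm
          simp only [D', hka, if_false, this]
          exact (hD k).sub (((wd_uu a).mul (hq k)).mono (by linarith))
      · have h1 := congrArg (sg a) h0
        rw [map_sum, map_zero] at h1
        rw [← h1]
        apply Finset.sum_congr rfl
        intro k _
        by_cases hka : k = a
        · simp [D', hka, sg_uu_self]
        · simp [D', hka, sg_uu_ne a k hka]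
    have hk : ∀ k, k ≠ a → D k = D' k + uu a * q0 k := by
      intro k hka
      by_cases hks : k ∈ s
      · simp only [D', q0, hka, hks, if_true, if_false]; exact hq' k
      · simp [D', q0, hka, hks, hs k (by simp [hka, hks])]
    have hD'0 : ∑ k ∈ Finset.univ.erase a, uu k * D' k = 0 := by
      have h1 := congrArg (sg a) h0
      rw [map_sum, map_zero, ← Finset.add_sum_erase _ _ (Finset.mem_univ a), map_mul,
        sg_uu_self, zero_mul, zero_add] at h1
      rw [← h1]
      apply Finset.sum_congr rfl
      intro k hk
      have hka := Finset.ne_of_mem_erase hk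
      simp [D', hka, sg_uu_ne a k hka]
    have hDa : D a = - ∑ k ∈ Finset.univ.erase a, uu k * q0 k := by
      rw [← sub_eq_zero]
      apply uu_cancel a
      rw [← Finset.add_sum_erase _ _ (Finset.mem_univ a)] at h0
      rw [← h0, ← add_zero (uu a * (D a - _)), ← hD'0]
      rw [sub_neg_eq_add, mul_add, add_assoc, Finset.mul_sum, ← Finset.sum_add_distrib]
      congr 1
      apply Finset.sum_congr rfl
      intro k hk'
      rw [hk k (Finset.ne_of_mem_erase hk')]
      ring
    have hdec : D = D' + ∑ k ∈ Finset.univ.erase a,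
        (Pi.single k (q0 k * uu a) - Pi.single a (q0 k * uu k)) := by
      funext l
      rw [Pi.add_apply, Finset.sum_apply]
      by_cases hla : l = a
      · subst hla
        rw [hDa]
        simp only [D', if_true, zero_add, ← Finset.sum_neg_distrib]
        apply Finset.sum_congr rfl
        intro k hk'
        have := Finset.ne_of_mem_erase hk'
        simp [this.symm, mul_comm]
      · rw [hk l hla, Finset.sum_eq_single l]
        · simp [hla, mul_comm]
        · intro b _ hb
          simp [hla, hb.symm]
        · intro h; exact absurd (by simp [hla]) h
    rw [hdec]
    refine add_mem hD'mem (sum_mem fun k hk' => AddSubmonoid.subset_closure ?_)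
    refine ⟨a, k, q0 k, (Finset.ne_of_mem_erase hk').symm, ?_, rfl⟩
    by_cases hks : k ∈ s
    · simpa [q0, hks] using hq k
    · simpa [q0, hks] using WD.zero (d - 1)

/-- Split of an exponent. -/
def e1 (m : Fin n ⊕ Fin n →₀ ℕ) : Fin n →₀ ℕ := (Finsupp.sumFinsuppAddEquivProdFinsupp m).1
/-- Split of an exponent. -/
def e2 (m : Fin n ⊕ Fin n →₀ ℕ) : Fin n →₀ ℕ := (Finsupp.sumFinsuppAddEquivProdFinsupp m).2

theorem e_add (a b : Fin n →₀ ℕ) :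
    e1 (a.mapDomain Sum.inl + b.mapDomain Sum.inr) = a ∧
    e2 (a.mapDomain Sum.inl + b.mapDomain Sum.inr) = b := by
  constructor
  · ext i
    change (a.mapDomain Sum.inl + b.mapDomain Sum.inr : Fin n ⊕ Fin n →₀ ℕ) (Sum.inl i) = a i
    rw [Finsupp.add_apply, Finsupp.mapDomain_apply Sum.inl_injective,
      Finsupp.mapDomain_of_notMem_range _ _ (by simp), add_zero]
  · ext i
    change (a.mapDomain Sum.inl + b.mapDomain Sum.inr : Fin n ⊕ Fin n →₀ ℕ) (Sum.inr i) = b i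
    rw [Finsupp.add_apply, Finsupp.mapDomain_apply Sum.inr_injective,
      Finsupp.mapDomain_of_notMem_range _ _ (by simp), zero_add]

theorem e_split (m : Fin n ⊕ Fin n →₀ ℕ) :
    m = (e1 m).mapDomain Sum.inl + (e2 m).mapDomain Sum.inr := by
  apply Finsupp.sumFinsuppAddEquivProdFinsupp.injective
  exact Prod.ext (e_add (e1 m) (e2 m)).1.symm (e_add (e1 m) (e2 m)).2.symm

theorem e_degree (m : Fin n ⊕ Fin n →₀ ℕ) :
    Finsupp.degree m = Finsupp.degree (e1 m) + Finsupp.degree (e2 m) := by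
  conv_lhs => rw [e_split m]
  rw [map_add, Finsupp.degree_mapDomain, Finsupp.degree_mapDomain]

theorem monomial_split (m : Fin n ⊕ Fin n →₀ ℕ) (c : R) :
    monomial m c = c • (toX (monomial (e1 m) 1) * toY (monomial (e2 m) 1)) := by
  unfold toX toY
  rw [rename_monomial, rename_monomial, monomial_mul, ← e_split]
  simp [smul_monomial]

/-- `L₁(x) L₂(y)` as a linear functional. -/
def BB (L₁ L₂ : MvPolynomial (Fin n) R →ₗ[R] R) : MvPolynomial (Fin n ⊕ Fin n) R →ₗ[R] R :=
  (basisMonomials (Fin n ⊕ Fin n) R).constr R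
    (fun m => L₁ (monomial (e1 m) 1) * L₂ (monomial (e2 m) 1))

theorem BB_monomial (L₁ L₂ : MvPolynomial (Fin n) R →ₗ[R] R) (m : Fin n ⊕ Fin n →₀ ℕ) (c : R) :
    BB L₁ L₂ (monomial m c) = c * (L₁ (monomial (e1 m) 1) * L₂ (monomial (e2 m) 1)) := by
  have h : (monomial m c : MvPolynomial (Fin n ⊕ Fin n) R) = c • basisMonomials _ R m := by
    simp [smul_monomial]
  rw [h, map_smul, BB, Module.Basis.constr_basis, smul_eq_mul]

theorem BB_eq (L₁ L₂ : MvPolynomial (Fin n) R →ₗ[R] R) (P : MvPolynomial (Fin n ⊕ Fin n) R) :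
    L₁ (applyY L₂ P) = BB L₁ L₂ P := by
  conv_rhs => rw [P.as_sum]
  rw [applyY, map_sum, map_sum]
  apply Finset.sum_congr rfl
  intro m _
  rw [BB_monomial, C_mul', map_smul, smul_eq_mul]
  change L₂ (monomial (e2 m) 1) * coeff m P * L₁ (monomial (e1 m) 1) = _
  ring

theorem BB_mul (L₁ L₂ : MvPolynomial (Fin n) R →ₗ[R] R) (p q : MvPolynomial (Fin n) R) :
    BB L₁ L₂ (toX p * toY q) = L₁ p * L₂ q := by
  induction p using MvPolynomial.induction_on' with
  | add p p' h h' => rw [map_add, add_mul, map_add, h, h', map_add, add_mul]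
  | monomial a c =>
    induction q using MvPolynomial.induction_on' with
    | add p p' h h' => rw [map_add, mul_add, map_add, h, h', map_add, mul_add]
    | monomial b c' =>
      have hc : ∀ (a : Fin n →₀ ℕ) (c : R), (monomial a c : MvPolynomial (Fin n) R)
          = c • monomial a 1 := by intro a c; simp [smul_monomial]
      unfold toX toY
      rw [rename_monomial, rename_monomial, monomial_mul, BB_monomial, (e_add a b).1,
        (e_add a b).2, hc a c, hc b c', map_smul, map_smul, smul_eq_mul, smul_eq_mul]
      ring

theorem swap_toX (p : MvPolynomial (Fin n) R) : rename Sum.swap (toX p) = toY p := by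
  unfold toX toY
  rw [rename_rename]; rfl

theorem swap_toY (p : MvPolynomial (Fin n) R) : rename Sum.swap (toY p) = toX p := by
  unfold toX toY
  rw [rename_rename]; rfl

theorem BB_swap (L₁ L₂ : MvPolynomial (Fin n) R →ₗ[R] R) (P : MvPolynomial (Fin n ⊕ Fin n) R) :
    BB L₂ L₁ P = BB L₁ L₂ (rename Sum.swap P) := by
  induction P using MvPolynomial.induction_on' with
  | add p p' h h' => rw [map_add, map_add, map_add, h, h']
  | monomial m c =>
    rw [monomial_split, map_smul, map_smul, map_smul, map_mul (rename _), swap_toX, swap_toY,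
      mul_comm (toY _), BB_mul, BB_mul, mul_comm (L₁ _)]

theorem BB_kill (L₁ L₂ : MvPolynomial (Fin n) R →ₗ[R] R) (p q : MvPolynomial (Fin n) R)
    (G : MvPolynomial (Fin n ⊕ Fin n) R)
    (h : ∀ m, coeff m G ≠ 0 → L₁ (p * monomial (e1 m) 1) = 0 ∨ L₂ (q * monomial (e2 m) 1) = 0) :
    BB L₁ L₂ (toX p * toY q * G) = 0 := by
  rw [G.as_sum, Finset.mul_sum, map_sum]
  apply Finset.sum_eq_zero
  intro m hm
  have h1 : toX p * toY q * monomial m (coeff m G) =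
      coeff m G • (toX (p * monomial (e1 m) 1) * toY (q * monomial (e2 m) 1)) := by
    rw [monomial_split, mul_smul_comm, map_mul, map_mul]
    congr 1
    ring
  rw [h1, map_smul, BB_mul]
  rcases h m (by simpa using hm) with h | h <;> simp [h]

theorem annul_apply {f : Fin n → MvPolynomial (Fin n) R} {d : ℤ}
    {L : MvPolynomial (Fin n) R →ₗ[R] R} (hL : Annuls L (boundedSpan f (d : WithBot ℤ)))
    (i : Fin n) (m : Fin n →₀ ℕ)
    (hm : ((f i).totalDegree : ℤ) + (Finsupp.degree m : ℕ) ≤ d) :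
    L (f i * monomial m 1) = 0 := by
  classical
  apply hL
  refine ⟨Pi.single i (monomial m 1), ?_, ?_⟩
  · rw [Finset.sum_eq_single i]
    · simp
    · intro b _ hb; simp [hb]
    · simp
  · intro j
    by_cases hj : j = i
    · subst hj
      rw [Pi.single_eq_same]
      have h1 := (mdeg_le_iff _ _).2 (wd_totalDegree (f j))
      have h2 := (mdeg_le_iff _ _).2 (WD.monomial (R := R) m 1)
      refine (add_le_add h1 h2).trans ?_
      rw [← WithBot.coe_add, WithBot.coe_le_coe]
      exact hm
    · rw [Pi.single_eq_of_ne hj]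
      have : mdeg (0 : MvPolynomial (Fin n) R) = ⊥ := by simp [mdeg]
      rw [this, WithBot.add_bot]
      exact bot_le

/-- The matrix with rows `∇^k h` and last row `t`. -/
def MM (Dh : Fin (n + 1) → Fin n → MvPolynomial (Fin n ⊕ Fin n) R)
    (t : Fin (n + 1) → MvPolynomial (Fin n ⊕ Fin n) R) :
    Matrix (Fin (n + 1)) (Fin (n + 1)) (MvPolynomial (Fin n ⊕ Fin n) R) :=
  fun r i => Fin.snoc (α := fun _ => MvPolynomial (Fin n ⊕ Fin n) R) (fun k => Dh i k) (t i) r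

theorem MM_castSucc (Dh : Fin (n + 1) → Fin n → MvPolynomial (Fin n ⊕ Fin n) R)
    (t : Fin (n + 1) → MvPolynomial (Fin n ⊕ Fin n) R) (k : Fin n) (i : Fin (n + 1)) :
    MM Dh t k.castSucc i = Dh i k := by
  simp [MM]

theorem MM_last (Dh : Fin (n + 1) → Fin n → MvPolynomial (Fin n ⊕ Fin n) R)
    (t : Fin (n + 1) → MvPolynomial (Fin n ⊕ Fin n) R) (i : Fin (n + 1)) :
    MM Dh t (Fin.last n) i = t i := by
  simp [MM]

theorem det_lastrow (h : Fin (n + 1) → MvPolynomial (Fin n) R)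
    (Dh : Fin (n + 1) → Fin n → MvPolynomial (Fin n ⊕ Fin n) R)
    (hD : ∀ i, ∑ k, uu k * Dh i k = toX (h i) - toY (h i)) :
    (MM Dh fun i => toY (h i)).det = (MM Dh fun i => toX (h i)).det := by
  have := Matrix.det_updateRow_sum (MM Dh fun i => toX (h i)) (Fin.last n)
    (Fin.snoc (α := fun _ => MvPolynomial (Fin n ⊕ Fin n) R) (fun k => - uu k) 1)
  rw [Fin.snoc_last, one_smul] at this
  rw [← this]
  congr 1
  ext1 r i
  refine Fin.lastCases ?_ (fun k => ?_) r
  · rw [Matrix.updateRow_self, MM_last, Finset.sum_apply, Fin.sum_univ_castSucc]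
    simp only [Pi.smul_apply, Fin.snoc_castSucc, Fin.snoc_last, MM_castSucc, MM_last, smul_eq_mul,
      neg_mul, Finset.sum_neg_distrib, hD]
    ring
  · rw [Matrix.updateRow_ne (Fin.castSucc_lt_last k).ne, MM_castSucc, MM_castSucc]

theorem key_det (h : Fin (n + 1) → MvPolynomial (Fin n) R)
    (Dh : Fin (n + 1) → Fin n → MvPolynomial (Fin n ⊕ Fin n) R)
    (hD : ∀ i, ∑ k, uu k * Dh i k = toX (h i) - toY (h i))
    (i : Fin (n + 1)) (j k : Fin n) (hjk : j ≠ k) :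
    (MM Dh fun i => toX (h i)).adjugate i k.castSucc * uu j
      - (MM Dh fun i => toX (h i)).adjugate i j.castSucc * uu k =
    - (((MM Dh fun i => toX (h i)).updateRow k.castSucc (Pi.single i 1)).updateRow j.castSucc
      (fun i => toY (h i))).det := by
  rw [Matrix.adjugate_apply, Matrix.adjugate_apply]
  set A := MM Dh fun i => toX (h i) with hA
  set N := A.updateRow k.castSucc (Pi.single i 1) with hN
  have hjk' : j.castSucc ≠ k.castSucc := fun h => hjk (Fin.castSucc_injective _ h)
  let c : Fin (n + 1) → MvPolynomial (Fin n ⊕ Fin n) R :=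
    Fin.snoc (α := fun _ => MvPolynomial (Fin n ⊕ Fin n) R)
      (fun l => if l = k then 0 else - uu l) 1
  have hrow : (fun i => toY (h i) : Fin (n + 1) → MvPolynomial (Fin n ⊕ Fin n) R) =
      (∑ r, c r • N r) + (- (uu k : MvPolynomial (Fin n ⊕ Fin n) R)) • A k.castSucc := by
    funext b
    rw [Pi.add_apply, Finset.sum_apply, Fin.sum_univ_castSucc]
    have hlast : N (Fin.last n) b = toX (h b) := by
      rw [hN, Matrix.updateRow_ne (Fin.castSucc_lt_last k).ne', hA, MM_last]
    have hs : ∑ l : Fin n, (c l.castSucc • N l.castSucc) b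
        = - (∑ l : Fin n, (uu l : MvPolynomial (Fin n ⊕ Fin n) R) * Dh b l) + uu k * Dh b k := by
      rw [← Finset.add_sum_erase _ _ (Finset.mem_univ k),
        ← Finset.add_sum_erase _ (fun l : Fin n => (uu l : MvPolynomial (Fin n ⊕ Fin n) R) * Dh b l) (Finset.mem_univ k)]
      have : ∑ l ∈ Finset.univ.erase k, (c l.castSucc • N l.castSucc) b
          = - ∑ l ∈ Finset.univ.erase k, uu l * Dh b l := by
        rw [← Finset.sum_neg_distrib]
        apply Finset.sum_congr rfl
        intro l hl
        have hlk := Finset.ne_of_mem_erase hl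
        have hlk' : l.castSucc ≠ k.castSucc := fun h => hlk (Fin.castSucc_injective _ h)
        rw [hN, Matrix.updateRow_ne hlk', Pi.smul_apply, hA, MM_castSucc]
        simp [c, hlk]
      rw [this]
      simp [c]
      ring
    rw [hs, hD, Pi.smul_apply, Pi.smul_apply, hlast, hA, MM_castSucc]
    simp [c]
    ring
  rw [hrow, Matrix.det_updateRow_add, Matrix.det_updateRow_sum, Matrix.det_updateRow_smul]
  have hc : c j.castSucc = - (uu j : MvPolynomial (Fin n ⊕ Fin n) R) := by simp [c, hjk]
  have hsw : (N.updateRow j.castSucc (A k.castSucc)).det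
      = - (A.updateRow j.castSucc (Pi.single i 1)).det := by
    have hp := Matrix.det_permute (Equiv.swap j.castSucc k.castSucc)
      (A.updateRow j.castSucc (Pi.single i 1))
    rw [Equiv.Perm.sign_swap hjk'] at hp
    have he : N.updateRow j.castSucc (A k.castSucc) =
        (A.updateRow j.castSucc (Pi.single i 1)).submatrix
          (Equiv.swap j.castSucc k.castSucc) id := by
      ext1 r b
      rw [Matrix.submatrix_apply, id]
      by_cases hr : r = j.castSucc
      · rw [hr, Matrix.updateRow_self, Equiv.swap_apply_left, Matrix.updateRow_ne hjk'.symm]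
      · rw [Matrix.updateRow_ne hr]
        by_cases hr' : r = k.castSucc
        · rw [hr', hN, Matrix.updateRow_self, Equiv.swap_apply_right, Matrix.updateRow_self]
        · rw [hN, Matrix.updateRow_ne hr', Equiv.swap_apply_of_ne_of_ne hr hr',
            Matrix.updateRow_ne hr]
    rw [he, hp]
    simp
  rw [hsw, hc, smul_eq_mul]
  ring

theorem kill_term (B : MvPolynomial (Fin n ⊕ Fin n) R →ₗ[R] R)
    (h : Fin (n + 1) → MvPolynomial (Fin n) R) (w : Fin (n + 1) → ℤ)
    (hB : ∀ a b G, a ≠ b → WD (∑ c, w c - 1 - w a - w b) G →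
      B (toX (h a) * toY (h b) * G) = 0)
    (Dh : Fin (n + 1) → Fin n → MvPolynomial (Fin n ⊕ Fin n) R)
    (hW : ∀ c k, WD (w c) (Dh c k))
    (i : Fin (n + 1)) (j k : Fin n) (hjk : j ≠ k) (A : MvPolynomial (Fin n ⊕ Fin n) R)
    (hA : WD (w i - 1) A) :
    B (A * (((MM Dh fun i => toX (h i)).updateRow k.castSucc (Pi.single i 1)).updateRow j.castSucc
      (fun i => toY (h i))).det) = 0 := by
  have hjk' : j.castSucc ≠ k.castSucc := fun h => hjk (Fin.castSucc_injective _ h)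
  have hkl : k.castSucc ≠ Fin.last n := (Fin.castSucc_lt_last k).ne
  have hjl : j.castSucc ≠ Fin.last n := (Fin.castSucc_lt_last j).ne
  set M := ((MM Dh fun i => toX (h i)).updateRow k.castSucc (Pi.single i 1)).updateRow j.castSucc
      (fun i => toY (h i)) with hM
  have hMk : ∀ b, M k.castSucc b = (Pi.single i 1 : Fin (n + 1) → _) b := by
    intro b; rw [hM, Matrix.updateRow_ne hjk'.symm, Matrix.updateRow_self]
  have hMj : ∀ b, M j.castSucc b = toY (h b) := by
    intro b; rw [hM, Matrix.updateRow_self]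
  have hMl : ∀ b, M (Fin.last n) b = toX (h b) := by
    intro b; rw [hM, Matrix.updateRow_ne hjl.symm, Matrix.updateRow_ne hkl.symm, MM_last]
  have hMo : ∀ r b, r ≠ k.castSucc → r ≠ j.castSucc → r ≠ Fin.last n → WD (w b) (M r b) := by
    intro r b h1 h2 h3
    rw [hM, Matrix.updateRow_ne h2, Matrix.updateRow_ne h1]
    obtain ⟨l, rfl⟩ := Fin.exists_castSucc_eq.2 h3
    rw [MM_castSucc]
    exact hW b l
  rw [Matrix.det_apply, Finset.mul_sum, map_sum]
  apply Finset.sum_eq_zero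
  intro s _
  rw [Units.smul_def, mul_smul_comm, map_zsmul]
  suffices hs : B (A * ∏ c, M (s c) c) = 0 by rw [hs, smul_zero]
  by_cases hi : s i = k.castSucc
  · obtain ⟨b, hb⟩ := s.surjective j.castSucc
    obtain ⟨a, ha⟩ := s.surjective (Fin.last n)
    have hbi : b ≠ i := by rintro rfl; exact hjk' (hb.symm.trans hi)
    have hai : a ≠ i := by rintro rfl; exact hkl (hi.symm.trans ha)
    have hab : a ≠ b := by rintro rfl; exact hjl (hb.symm.trans ha)
    have m1 : b ∈ Finset.univ.erase i := by simp [hbi]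
    have m2 : a ∈ (Finset.univ.erase i).erase b := by simp [hai, hab]
    have hprod : ∏ c, M (s c) c =
        toX (h a) * toY (h b) * ∏ c ∈ ((Finset.univ.erase i).erase b).erase a, M (s c) c := by
      rw [← Finset.mul_prod_erase _ _ (Finset.mem_univ i), ← Finset.mul_prod_erase _ _ m1,
        ← Finset.mul_prod_erase _ _ m2, hi, hb, ha, hMk, hMj, hMl, Pi.single_eq_same]
      ring
    have hsum : ∑ c ∈ ((Finset.univ.erase i).erase b).erase a, w c
        = ∑ c, w c - w i - w b - w a := by
      rw [← Finset.add_sum_erase _ _ (Finset.mem_univ i), ← Finset.add_sum_erase _ _ m1,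
        ← Finset.add_sum_erase _ _ m2]
      ring
    have hG := WD.prod (((Finset.univ.erase i).erase b).erase a) (fun c => M (s c) c) w (by
      intro c hc
      simp only [Finset.mem_erase, Finset.mem_univ, and_true] at hc
      apply hMo
      · rw [← hi]; exact fun e => hc.2.2 (s.injective e)
      · rw [← hb]; exact fun e => hc.2.1 (s.injective e)
      · rw [← ha]; exact fun e => hc.1 (s.injective e))
    rw [hprod, mul_left_comm]
    apply hB a b _ hab
    refine (hA.mul hG).mono ?_
    rw [hsum]
    linarith
  · obtain ⟨b, hb⟩ := s.surjective k.castSucc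
    have hbi : b ≠ i := by rintro rfl; exact hi hb
    have : ∏ c, M (s c) c = 0 := by
      apply Finset.prod_eq_zero (Finset.mem_univ b)
      rw [hb, hMk, Pi.single_eq_of_ne hbi]
    rw [this, mul_zero, map_zero]

theorem one_col (B : MvPolynomial (Fin n ⊕ Fin n) R →ₗ[R] R)
    (h : Fin (n + 1) → MvPolynomial (Fin n) R) (w : Fin (n + 1) → ℤ)
    (hB : ∀ a b G, a ≠ b → WD (∑ c, w c - 1 - w a - w b) G →
      B (toX (h a) * toY (h b) * G) = 0)
    (Dh : Fin (n + 1) → Fin n → MvPolynomial (Fin n ⊕ Fin n) R)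
    (hW : ∀ c k, WD (w c) (Dh c k))
    (hD : ∀ i, ∑ k, uu k * Dh i k = toX (h i) - toY (h i))
    (i : Fin (n + 1)) (E : Fin n → MvPolynomial (Fin n ⊕ Fin n) R)
    (hE : ∀ k, WD (w i) (E k)) (hE' : ∑ k, uu k * E k = toX (h i) - toY (h i)) :
    B (MM (Function.update Dh i E) fun i => toX (h i)).det
      = B (MM Dh fun i => toX (h i)).det := by
  set A := MM Dh fun i => toX (h i) with hA
  have hcl : ∀ v ∈ AddSubmonoid.closure (koszulSet R n (w i)),
      B (∑ k, A.adjugate i (Fin.castSucc k) * v k) = 0 := by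
    intro v hv
    induction hv using AddSubmonoid.closure_induction with
    | zero => simp
    | add x y _ _ hx hy =>
      simp only [Pi.add_apply, mul_add, Finset.sum_add_distrib, map_add, hx, hy, add_zero]
    | mem x hx =>
      obtain ⟨j, k, G, hjk, hG, rfl⟩ := hx
      have : ∑ l, A.adjugate i (Fin.castSucc l) *
          (Pi.single k (G * uu j) - Pi.single j (G * uu k) :
            Fin n → MvPolynomial (Fin n ⊕ Fin n) R) l =
          G * (A.adjugate i k.castSucc * uu j - A.adjugate i j.castSucc * uu k) := by
        simp only [Pi.sub_apply, mul_sub, Finset.sum_sub_distrib, Pi.single_apply, mul_ite,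
          mul_zero, Finset.sum_ite_eq', Finset.sum_ite_eq, Finset.mem_univ, if_true]
        ring
      rw [this, hA, key_det h Dh hD i j k hjk, mul_neg, map_neg,
        kill_term B h w hB Dh hW i j k hjk G hG, neg_zero]
  have hdet : ∀ E' : Fin n → MvPolynomial (Fin n ⊕ Fin n) R,
      (MM (Function.update Dh i E') fun i => toX (h i)).det =
      ∑ k, A.adjugate i (Fin.castSucc k) * E' k + A.adjugate i (Fin.last n) * toX (h i) := by
    intro E'
    have h1 : (MM (Function.update Dh i E') fun i => toX (h i)) =
        A.updateCol i (Fin.snoc (α := fun _ => MvPolynomial (Fin n ⊕ Fin n) R) E'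
          (toX (h i))) := by
      ext1 r b
      by_cases hb : b = i
      · subst hb
        rw [Matrix.updateCol_self]
        simp [MM]
      · rw [Matrix.updateCol_ne hb]
        simp [MM, hA, hb]
    rw [h1, ← Matrix.cramer_apply, Matrix.cramer_eq_adjugate_mulVec, Matrix.mulVec, dotProduct,
      Fin.sum_univ_castSucc]
    simp
  have h2 := hdet E
  have h3 := hdet (Dh i)
  rw [Function.update_eq_self, ← hA] at h3
  rw [h2, h3, ← sub_eq_zero, ← map_sub, add_sub_add_right_eq_sub, ← Finset.sum_sub_distrib]
  rw [← hcl (E - Dh i)]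
  · congr 1
    apply Finset.sum_congr rfl
    intro k _
    rw [Pi.sub_apply, mul_sub]
  · apply koszul (w i) Finset.univ
    · simp
    · intro k; exact (hE k).sub (hW i k)
    · simp only [Pi.sub_apply, mul_sub, Finset.sum_sub_distrib, hE', hD, sub_self]

theorem all_cols (B : MvPolynomial (Fin n ⊕ Fin n) R →ₗ[R] R)
    (h : Fin (n + 1) → MvPolynomial (Fin n) R) (w : Fin (n + 1) → ℤ)
    (hB : ∀ a b G, a ≠ b → WD (∑ c, w c - 1 - w a - w b) G →
      B (toX (h a) * toY (h b) * G) = 0)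
    (Dh E : Fin (n + 1) → Fin n → MvPolynomial (Fin n ⊕ Fin n) R)
    (hW : ∀ c k, WD (w c) (Dh c k))
    (hD : ∀ i, ∑ k, uu k * Dh i k = toX (h i) - toY (h i))
    (hE : ∀ c k, WD (w c) (E c k))
    (hE' : ∀ i, ∑ k, uu k * E i k = toX (h i) - toY (h i)) :
    B (MM E fun i => toX (h i)).det = B (MM Dh fun i => toX (h i)).det := by
  have main : ∀ s : Finset (Fin (n + 1)),
      B (MM (fun c => if c ∈ s then E c else Dh c) fun i => toX (h i)).det
        = B (MM Dh fun i => toX (h i)).det := by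
    intro s
    induction s using Finset.induction_on with
    | empty => simp
    | insert a s ha ih =>
      rw [← ih, ← one_col B h w hB (fun c => if c ∈ s then E c else Dh c) _ _ a (E a) (hE a)
        (hE' a)]
      · congr 2
        congr 1
        funext c
        by_cases hc : c = a
        · subst hc; simp
        · simp [hc]
      · intro c k
        by_cases hc : c ∈ s
        · simpa [hc] using hE c k
        · simpa [hc] using hW c k
      · intro c
        by_cases hc : c ∈ s
        · simpa [hc] using hE' c
        · simpa [hc] using hD c
  simpa using main Finset.univ

/-- Theorem 4: the extension operation is symmetric in the two bounded
root functionals `L₁` and `L₂` on polynomials of degree `≤ δ_f + δ₁ + δ₂ + 1`. -/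
theorem extension_symm {R : Type*} [CommRing R] {n : ℕ}
    (f : Fin n → MvPolynomial (Fin n) R) (hf : ∀ i, (1 : WithBot ℤ) ≤ mdeg (f i))
    (δ₁ δ₂ : ℤ) (hδ₁ : 0 ≤ δ₁) (hδ₂ : 0 ≤ δ₂)
    (L₁ L₂ : MvPolynomial (Fin n) R →ₗ[R] R)
    (hL₁ : Annuls L₁ (boundedSpan f ((deltaF f + δ₁ : ℤ) : WithBot ℤ)))
    (hL₂ : Annuls L₂ (boundedSpan f ((deltaF f + δ₂ : ℤ) : WithBot ℤ)))
    (Df : Fin n → Fin n → MvPolynomial (Fin n ⊕ Fin n) R)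
    (hDf : ∀ i, IsDiffDeriv (f i) (Df i) ∧ IsMonotonous (f i) (Df i))
    (F : MvPolynomial (Fin n) R)
    (hF : mdeg F ≤ ((deltaF f + δ₁ + δ₂ + 1 : ℤ) : WithBot ℤ))
    (DF : Fin n → MvPolynomial (Fin n ⊕ Fin n) R)
    (hDF : IsDiffDeriv F DF ∧ IsMonotonous F DF) :
    L₁ (applyY L₂ (ddetX f Df F DF)) = L₂ (applyY L₁ (ddetX f Df F DF)) := by
  let h : Fin (n + 1) → MvPolynomial (Fin n) R :=
    Fin.snoc (α := fun _ => MvPolynomial (Fin n) R) f F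
  let Dh : Fin (n + 1) → Fin n → MvPolynomial (Fin n ⊕ Fin n) R :=
    Fin.snoc (α := fun _ => Fin n → MvPolynomial (Fin n ⊕ Fin n) R) Df DF
  let w : Fin (n + 1) → ℤ := Fin.snoc (α := fun _ => ℤ)
    (fun i => ((f i).totalDegree : ℤ) - 1) (deltaF f + δ₁ + δ₂)
  have hF' : WD (deltaF f + δ₁ + δ₂ + 1) F := (mdeg_le_iff _ _).1 hF
  have hW : ∀ c k, WD (w c) (Dh c k) := by
    intro c k
    refine Fin.lastCases ?_ (fun i => ?_) c
    · simp only [w, Dh, Fin.snoc_last]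
      exact (WD.of_mono hDF.2 hF' k).mono (by linarith)
    · simp only [w, Dh, Fin.snoc_castSucc]
      exact WD.of_mono (hDf i).2 (wd_totalDegree (f i)) k
  have hD : ∀ i, ∑ k, uu k * Dh i k = toX (h i) - toY (h i) := by
    intro c
    refine Fin.lastCases ?_ (fun i => ?_) c
    · simp only [h, Dh, Fin.snoc_last]
      exact hDF.1
    · simp only [h, Dh, Fin.snoc_castSucc]
      exact (hDf i).1
  have hsum : ∑ c, w c = deltaF f + (deltaF f + δ₁ + δ₂) := by
    rw [Fin.sum_univ_castSucc]
    simp only [w, Fin.snoc_castSucc, Fin.snoc_last]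
    rfl
  have hdet : ddetX f Df F DF = (MM Dh fun i => toX (h i)).det := by
    unfold ddetX
    congr 1
    ext1 r c
    refine Fin.lastCases ?_ (fun k => ?_) r <;> refine Fin.lastCases ?_ (fun i => ?_) c <;>
      simp [MM, Dh, h]
  have hB : ∀ a b G, a ≠ b → WD (∑ c, w c - 1 - w a - w b) G →
      BB L₁ L₂ (toX (h a) * toY (h b) * G) = 0 := by
    intro a b G hab hG
    rw [hsum] at hG
    apply BB_kill
    intro m hm
    have hm' := hG m hm
    rw [e_degree] at hm'
    push_cast at hm'
    have p1 : (0 : ℤ) ≤ (Finsupp.degree (e1 m) : ℕ) := by positivity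
    have p2 : (0 : ℤ) ≤ (Finsupp.degree (e2 m) : ℕ) := by positivity
    revert hab hm'
    refine Fin.lastCases ?_ (fun i => ?_) a <;> refine Fin.lastCases ?_ (fun j => ?_) b
    · intro hab; exact absurd rfl hab
    · intro _ hm'
      right
      simp only [w, h, Fin.snoc_castSucc, Fin.snoc_last] at hm' ⊢
      exact annul_apply hL₂ j _ (by linarith)
    · intro _ hm'
      left
      simp only [w, h, Fin.snoc_castSucc, Fin.snoc_last] at hm' ⊢
      exact annul_apply hL₁ i _ (by linarith)
    · intro _ hm'
      simp only [w, h, Fin.snoc_castSucc] at hm' ⊢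
      by_cases hc : ((f i).totalDegree : ℤ) + (Finsupp.degree (e1 m) : ℕ) ≤ deltaF f + δ₁
      · left; exact annul_apply hL₁ i _ hc
      · right; exact annul_apply hL₂ j _ (by push Not at hc; linarith)
  let E : Fin (n + 1) → Fin n → MvPolynomial (Fin n ⊕ Fin n) R :=
    fun c k => rename Sum.swap (Dh c k)
  have hE : ∀ c k, WD (w c) (E c k) := fun c k => (hW c k).rename _
  have hE' : ∀ i, ∑ k, uu k * E i k = toX (h i) - toY (h i) := by
    intro i
    have h1 := congrArg (rename Sum.swap) (hD i)
    rw [map_sum, map_sub, swap_toX, swap_toY] at h1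
    rw [← neg_sub (toY (h i)), ← h1, ← Finset.sum_neg_distrib]
    apply Finset.sum_congr rfl
    intro k _
    simp only [uu, E, map_mul, map_sub, rename_X, Sum.swap_inl, Sum.swap_inr]
    ring
  rw [BB_eq, BB_eq, BB_swap L₁ L₂, hdet]
  have hsw : rename Sum.swap (MM Dh fun i => toX (h i)).det = (MM E fun i => toX (h i)).det := by
    rw [← det_lastrow h E hE', AlgHom.map_det]
    congr 1
    ext1 r c
    rw [AlgHom.mapMatrix_apply, Matrix.map_apply]
    refine Fin.lastCases ?_ (fun k => ?_) r
    · rw [MM_last, MM_last, swap_toX]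
    · rw [MM_castSucc, MM_castSucc]
  rw [hsw]
  exact (all_cols (BB L₁ L₂) h w hB Dh E hW hD hE hE').symm

end
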